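/- Let f, g ∈ Ω̄(X,Y). Then f and g are R-related in Ω̄(X,Y) if and only if ker(f) = ker(g) (f and g induce the same partition of X into fibers) and the collection of fibers of f meeting Y via points of Y equals that of g, i.e., {f^{-1}(x) : x ∈ f(X) ∩ Y} = {g^{-1}(x) : x ∈ g(X) ∩ Y}. -/

import Mathlib

/-- If `f` is constant on the fibers of `g`, if `f` and `g` send the same points into `Y`, and if
both have range containing `Y`, then `f` factors through `g` via a map with `h '' Y = Y`. -/
theorem exists_image_eq_and_eq_comp {X : Type*} {Y : Set X} {f g : X → X}
    (hf : Y ⊆ Set.range f) (hg : Y ⊆ Set.range g) (hker : ∀ a b : X, g a = g b → f a = f b)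
    (hmem : ∀ a, f a ∈ Y ↔ g a ∈ Y) : ∃ h : X → X, h '' Y = Y ∧ f = h ∘ g := by
  have hext : ∀ a, Function.extend g f id (g a) = f a :=
    Function.FactorsThrough.extend_apply (fun a b => hker a b) id
  refine ⟨Function.extend g f id, Set.Subset.antisymm ?_ ?_, funext fun a => (hext a).symm⟩
  · rintro _ ⟨y, hy, rfl⟩
    obtain ⟨a, rfl⟩ := hg hy
    rw [hext]
    exact (hmem a).2 hy
  · intro x hx
    obtain ⟨a, rfl⟩ := hf hx
    exact ⟨g a, (hmem a).1 hx, hext a⟩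

/-- The fibers over points of `Y` are the fibers of the points sent into `Y`. -/
theorem setOf_fiber_eq {X : Type*} (Y : Set X) (f : X → X) :
    {s : Set X | ∃ x ∈ Set.range f ∩ Y, s = f ⁻¹' {x}}
      = {s : Set X | ∃ a, f a ∈ Y ∧ s = {b | f b = f a}} := by
  ext s
  constructor
  · rintro ⟨_, ⟨⟨a, rfl⟩, ha⟩, rfl⟩
    exact ⟨a, ha, rfl⟩
  · rintro ⟨a, ha, rfl⟩
    exact ⟨f a, ⟨⟨a, rfl⟩, ha⟩, rfl⟩

/-- If every fiber of `f` over a point of `Y` is a fiber of `g` over a point of `Y`, then `g` sends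
into `Y` every point that `f` does. -/
theorem mem_of_setOf_fiber_subset {X : Type*} {Y : Set X} {f g : X → X}
    (h : {s : Set X | ∃ x ∈ Set.range f ∩ Y, s = f ⁻¹' {x}}
      ⊆ {s : Set X | ∃ x ∈ Set.range g ∩ Y, s = g ⁻¹' {x}}) {a : X} (ha : f a ∈ Y) :
    g a ∈ Y := by
  obtain ⟨x, ⟨-, hx⟩, hs⟩ := h ⟨f a, ⟨⟨a, rfl⟩, ha⟩, rfl⟩
  have hax : a ∈ g ⁻¹' {x} := hs ▸ (rfl : f a = f a)
  rwa [show g a = x from hax]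

theorem stmt_14 {X : Type*} (Y : Set X) (hY : Y.Nonempty)
    (f g : X → X) (hf : f '' Y = Y) (hg : g '' Y = Y) :
    ((∃ h : X → X, h '' Y = Y ∧ f = h ∘ g) ∧ (∃ h' : X → X, h' '' Y = Y ∧ g = h' ∘ f))
      ↔ (∀ a b : X, f a = f b ↔ g a = g b) ∧
        {s : Set X | ∃ x ∈ Set.range f ∩ Y, s = f ⁻¹' {x}}
          = {s : Set X | ∃ x ∈ Set.range g ∩ Y, s = g ⁻¹' {x}} := by
  constructor
  · rintro ⟨⟨h, hh, hfg⟩, h', hh', hgf⟩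
    have hker : ∀ a b : X, f a = f b ↔ g a = g b := fun a b =>
      ⟨fun e => by rw [hgf, Function.comp_apply, e, Function.comp_apply],
        fun e => by rw [hfg, Function.comp_apply, e, Function.comp_apply]⟩
    have hmem : ∀ a, f a ∈ Y ↔ g a ∈ Y := fun a =>
      ⟨fun ha => by
        rw [hgf, ← hh']
        exact Set.mem_image_of_mem h' ha,
      fun ha => by
        rw [hfg, ← hh]
        exact Set.mem_image_of_mem h ha⟩
    refine ⟨hker, ?_⟩
    rw [setOf_fiber_eq, setOf_fiber_eq]
    simp only [hker, hmem]
  · rintro ⟨hker, hfib⟩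
    have hmem : ∀ a, f a ∈ Y ↔ g a ∈ Y := fun a =>
      ⟨mem_of_setOf_fiber_subset hfib.subset, mem_of_setOf_fiber_subset hfib.superset⟩
    have hfr : Y ⊆ Set.range f := hf.superset.trans (Set.image_subset_range f Y)
    have hgr : Y ⊆ Set.range g := hg.superset.trans (Set.image_subset_range g Y)
    exact ⟨exists_image_eq_and_eq_comp hfr hgr (fun a b => (hker a b).2) hmem,
      exists_image_eq_and_eq_comp hgr hfr (fun a b => (hker a b).1) fun a => (hmem a).symm⟩
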